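/- arXiv:1412.8693 — 3 statements merged into one kernel-verified Lean document; each statement's English description precedes it below -/
import Mathlib

section
/- In any Minkowski space, the Jung constant is attained by a complete body: j(M^n) = max over complete convex bodies K of R(K)/D(K). -/
open Set Pointwise

/-- `V n` is `ℝ^n` (as a Euclidean space, also used as carrier for general
Minkowski spaces whose unit ball `B` is given as a set). -/
abbrev V (n : ℕ) := EuclideanSpace ℝ (Fin n)

/-- A convex body: compact, convex, with nonempty interior. -/
def IsConvexBody {n : ℕ} (K : Set (V n)) : Prop :=
  Convex ℝ K ∧ IsCompact K ∧ (interior K).Nonempty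

/-- A (centrally) symmetric unit ball of a norm. -/
def IsSymUnitBall {n : ℕ} (B : Set (V n)) : Prop :=
  IsConvexBody B ∧ B = -B

/-- Circumradius of `K` with respect to the unit ball `B`. -/
noncomputable def circum {n : ℕ} (B K : Set (V n)) : ℝ :=
  sInf {ρ : ℝ | 0 < ρ ∧ ∃ c : V n, K ⊆ c +ᵥ ρ • B}

/-- Inradius of `K` with respect to the unit ball `B`. -/
noncomputable def inrad {n : ℕ} (B K : Set (V n)) : ℝ :=
  sSup {ρ : ℝ | 0 < ρ ∧ ∃ c : V n, c +ᵥ ρ • B ⊆ K}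

/-- Diameter of `K` in the norm with unit ball `B` (via the Minkowski gauge). -/
noncomputable def mdiam {n : ℕ} (B K : Set (V n)) : ℝ :=
  sSup {d : ℝ | ∃ x ∈ K, ∃ y ∈ K, d = gauge B (x - y)}

/-- Minkowski asymmetry of `K`. -/
noncomputable def asym {n : ℕ} (K : Set (V n)) : ℝ :=
  sInf {ρ : ℝ | 0 < ρ ∧ ∃ c : V n, -K ⊆ c +ᵥ ρ • K}

/-- `K` is complete (diametrically maximal) w.r.t. the unit ball `B`. -/
def IsCompleteBody {n : ℕ} (B K : Set (V n)) : Prop :=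
  IsConvexBody K ∧ ∀ x : V n, x ∉ K → mdiam B K < mdiam B (K ∪ {x})

/-- `Kstar` is a completion of `K` w.r.t. the unit ball `B`. -/
def IsCompletionOf {n : ℕ} (B Kstar K : Set (V n)) : Prop :=
  IsCompleteBody B Kstar ∧ K ⊆ Kstar ∧ mdiam B Kstar = mdiam B K

/-- Jung ratio `R(K)/D(K)`. -/
noncomputable def jungRatio {n : ℕ} (B K : Set (V n)) : ℝ :=
  circum B K / mdiam B K

/-- Jung constant of the Minkowski space with unit ball `B`. -/
noncomputable def jungConst {n : ℕ} (B : Set (V n)) : ℝ :=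
  sSup {j : ℝ | ∃ K : Set (V n), IsConvexBody K ∧ j = jungRatio B K}

/-- Maximal Minkowski asymmetry over complete bodies. -/
noncomputable def asymConst {n : ℕ} (B : Set (V n)) : ℝ :=
  sSup {s : ℝ | ∃ K : Set (V n), IsCompleteBody B K ∧ s = asym K}

/-- Banach–Mazur distance between `K` and `C`. -/
noncomputable def dBM {n : ℕ} (K C : Set (V n)) : ℝ :=
  sInf {ρ : ℝ | 0 < ρ ∧ ∃ (A : (V n) ≃ᵃ[ℝ] (V n)) (x : V n),
    K ⊆ A '' C ∧ A '' C ⊆ x +ᵥ ρ • K}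

/-- `S` is a `k`-dimensional simplex. -/
def IsSimplexDim {n : ℕ} (k : ℕ) (S : Set (V n)) : Prop :=
  ∃ v : Fin (k + 1) → V n, AffineIndependent ℝ v ∧ S = convexHull ℝ (Set.range v)

/-- Helly property with parameter `k` for translates of `B`. -/
def HellyProp {n : ℕ} (B : Set (V n)) (k : ℕ) : Prop :=
  ∀ X : Set (V n), X.Nonempty →
    (∀ J : Finset (V n), ↑J ⊆ X → J.card ≤ k + 1 →
      (⋂ x ∈ (J : Set (V n)), (x +ᵥ B)).Nonempty) →
    (⋂ x ∈ X, (x +ᵥ B)).Nonempty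

/-- Helly dimension of `B`: the least positive `k` with the Helly property. -/
noncomputable def hellyDim {n : ℕ} (B : Set (V n)) : ℕ :=
  sInf {k : ℕ | 0 < k ∧ HellyProp B k}

/-- `K` is of constant width w.r.t. the unit ball `B`: `K - K` is a dilate of `B`. -/
def IsConstWidth {n : ℕ} (B K : Set (V n)) : Prop :=
  ∃ γ : ℝ, 0 < γ ∧ K - K = γ • B

/-- A regular `n`-simplex in Euclidean space. -/
def IsRegularSimplex {n : ℕ} (T : Set (V n)) : Prop :=
  ∃ v : Fin (n + 1) → V n, AffineIndependent ℝ v ∧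
    (∀ i j k l, i ≠ j → k ≠ l → dist (v i) (v j) = dist (v k) (v l)) ∧
    T = convexHull ℝ (Set.range v)

/-- The Euclidean unit ball in `ℝ^n`. -/
noncomputable def euclBall (n : ℕ) : Set (V n) := Metric.closedBall 0 1

/-- Pseudo completion of `K` with respect to the circumcenter `c`. -/
noncomputable def pseudoCompletion {n : ℕ} (B K : Set (V n)) (c : V n) : Set (V n) :=
  convexHull ℝ (K ∪ (c +ᵥ (mdiam B K - circum B K) • B))

open Topology TopologicalSpace

namespace IsSymUnitBall

variable {n : ℕ} {B : Set (V n)}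

lemma neg_mem (hB : IsSymUnitBall B) {x : V n} (hx : x ∈ B) : -x ∈ B := by
  rw [hB.2]
  simpa using hx

lemma mem_nhds_zero (hB : IsSymUnitBall B) : B ∈ 𝓝 (0 : V n) := by
  obtain ⟨x, hx⟩ := hB.1.2.2
  have hx' : -x ∈ interior B := by
    have h : -x ∈ -interior B := by simpa using hx
    have hopen : IsOpen (-interior B) := isOpen_interior.neg
    refine interior_maximal ?_ hopen h
    intro y hy
    simpa using hB.neg_mem (interior_subset hy)
  have h := hB.1.1.interior.midpoint_mem hx hx'
  rw [midpoint_self_neg] at h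
  exact mem_interior_iff_mem_nhds.1 h

lemma gauge_sub_comm (hB : IsSymUnitBall B) (x y : V n) :
    gauge B (x - y) = gauge B (y - x) := by
  rw [← neg_sub, gauge_neg fun _ => hB.neg_mem]

lemma continuous_gauge (hB : IsSymUnitBall B) : Continuous (gauge B) :=
  _root_.continuous_gauge hB.1.1 hB.mem_nhds_zero

lemma gauge_sub_le (hB : IsSymUnitBall B) (x y z : V n) :
    gauge B (x - z) ≤ gauge B (x - y) + gauge B (y - z) := by
  simpa using gauge_add_le hB.1.1 (absorbent_nhds_zero hB.mem_nhds_zero) (x - y) (y - z)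

lemma gauge_le_one_iff (hB : IsSymUnitBall B) {x : V n} : gauge B x ≤ 1 ↔ x ∈ B := by
  rw [gauge_le_one_iff_mem_closure hB.1.1 hB.mem_nhds_zero, hB.1.2.1.isClosed.closure_eq]

lemma mem_vadd_smul_iff (hB : IsSymUnitBall B) {ρ : ℝ} (hρ : 0 < ρ) {c x : V n} :
    x ∈ c +ᵥ ρ • B ↔ gauge B (x - c) ≤ ρ := by
  rw [mem_vadd_set_iff_neg_vadd_mem, mem_smul_set_iff_inv_smul_mem₀ hρ.ne',
    ← hB.gauge_le_one_iff, gauge_smul_of_nonneg (inv_nonneg.2 hρ.le), smul_eq_mul,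
    inv_mul_le_one₀ hρ, vadd_eq_add, neg_add_eq_sub]

lemma convex_setOf_gauge_sub_le (hB : IsSymUnitBall B) (c : V n) (ρ : ℝ) :
    Convex ℝ {x | gauge B (x - c) ≤ ρ} := by
  have h := (hB.1.1.setOfPred_gauge_le (mem_of_mem_nhds hB.mem_nhds_zero)
    (absorbent_nhds_zero hB.mem_nhds_zero) ρ).translate_preimage_right (-c)
  simpa [Set.preimage, neg_add_eq_sub] using h

lemma isClosed_setOf_gauge_sub_le (hB : IsSymUnitBall B) (c : V n) (ρ : ℝ) :
    IsClosed {x | gauge B (x - c) ≤ ρ} :=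
  isClosed_le (hB.continuous_gauge.comp (continuous_id.sub continuous_const)) continuous_const

lemma isCompact_setOf_gauge_sub_le_one (hB : IsSymUnitBall B) (c : V n) :
    IsCompact {x | gauge B (x - c) ≤ 1} := by
  have h : {x | gauge B (x - c) ≤ 1} = c +ᵥ (1 : ℝ) • B := by
    ext x
    exact (hB.mem_vadd_smul_iff one_pos).symm
  rw [h, one_smul]
  exact hB.1.2.1.vadd c

end IsSymUnitBall

section Radius

variable {n : ℕ} {B K L : Set (V n)}

lemma bddBelow_circum (B K : Set (V n)) :
    BddBelow {ρ : ℝ | 0 < ρ ∧ ∃ c : V n, K ⊆ c +ᵥ ρ • B} :=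
  ⟨0, fun _ h => h.1.le⟩

lemma circum_nonneg (B K : Set (V n)) : 0 ≤ circum B K :=
  Real.sInf_nonneg fun _ h => h.1.le

lemma circum_le (hB : IsSymUnitBall B) {ρ : ℝ} (hρ : 0 < ρ) (c : V n)
    (h : ∀ x ∈ K, gauge B (x - c) ≤ ρ) : circum B K ≤ ρ :=
  csInf_le (bddBelow_circum B K) ⟨hρ, c, fun x hx => (hB.mem_vadd_smul_iff hρ).2 (h x hx)⟩

/-- The gauge distances realised in a bounded set are bounded, so `mdiam` is a true supremum. -/
lemma bddAbove_gauge_sub (hB : IsSymUnitBall B) (hK : IsCompact K) :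
    BddAbove {d : ℝ | ∃ x ∈ K, ∃ y ∈ K, d = gauge B (x - y)} := by
  have h := ((hK.prod hK).image
    (hB.continuous_gauge.comp (continuous_fst.sub continuous_snd))).bddAbove
  refine h.mono ?_
  rintro _ ⟨x, hx, y, hy, rfl⟩
  exact ⟨(x, y), ⟨hx, hy⟩, rfl⟩

lemma gauge_sub_le_mdiam (hB : IsSymUnitBall B) (hK : IsCompact K) {x y : V n}
    (hx : x ∈ K) (hy : y ∈ K) : gauge B (x - y) ≤ mdiam B K :=
  le_csSup (bddAbove_gauge_sub hB hK) ⟨x, hx, y, hy, rfl⟩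

lemma mdiam_nonneg (B K : Set (V n)) : 0 ≤ mdiam B K :=
  Real.sSup_nonneg (by rintro _ ⟨x, -, y, -, rfl⟩; exact gauge_nonneg _)

lemma mdiam_le {d : ℝ} (hd : 0 ≤ d) (h : ∀ x ∈ K, ∀ y ∈ K, gauge B (x - y) ≤ d) :
    mdiam B K ≤ d :=
  Real.sSup_le (by rintro _ ⟨x, hx, y, hy, rfl⟩; exact h x hx y hy) hd

lemma circum_set_nonempty (hB : IsSymUnitBall B) (hK : IsCompact K) :
    {ρ : ℝ | 0 < ρ ∧ ∃ c : V n, K ⊆ c +ᵥ ρ • B}.Nonempty := by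
  obtain ⟨M, hM⟩ := (hK.image hB.continuous_gauge).bddAbove
  have hρ : 0 < max M 1 := lt_max_of_lt_right one_pos
  refine ⟨max M 1, hρ, 0, fun x hx => (hB.mem_vadd_smul_iff hρ).2 ?_⟩
  rw [sub_zero]
  exact (hM ⟨x, hx, rfl⟩).trans (le_max_left _ _)

lemma exists_of_circum_lt (hB : IsSymUnitBall B) (hK : IsCompact K) {r : ℝ}
    (h : circum B K < r) : ∃ ρ, 0 < ρ ∧ ρ < r ∧ ∃ c, ∀ x ∈ K, gauge B (x - c) ≤ ρ := by
  obtain ⟨ρ, ⟨hρ, c, hc⟩, hlt⟩ := exists_lt_of_csInf_lt (circum_set_nonempty hB hK) h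
  exact ⟨ρ, hρ, hlt, c, fun x hx => (hB.mem_vadd_smul_iff hρ).1 (hc hx)⟩

lemma circum_mono (hB : IsSymUnitBall B) (hL : IsCompact L) (h : K ⊆ L) :
    circum B K ≤ circum B L :=
  csInf_le_csInf (bddBelow_circum B K) (circum_set_nonempty hB hL)
    fun _ ⟨hρ, c, hc⟩ => ⟨hρ, c, h.trans hc⟩

lemma circum_le_mdiam (hB : IsSymUnitBall B) (hK : IsCompact K) (hne : K.Nonempty) :
    circum B K ≤ mdiam B K := by
  obtain ⟨x, hx⟩ := hne
  refine le_of_forall_gt_imp_ge_of_dense fun ρ hρ => ?_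
  exact circum_le hB ((mdiam_nonneg B K).trans_lt hρ) x
    fun y hy => (gauge_sub_le_mdiam hB hK hy hx).trans hρ.le

lemma upperSemicontinuous_circum (hB : IsSymUnitBall B) :
    UpperSemicontinuous fun K : NonemptyCompacts (V n) => circum B K := by
  intro K r hr
  obtain ⟨ρ, hρ, hρr, c, hc⟩ := exists_of_circum_lt hB K.isCompact hr
  obtain ⟨σ, hρσ, hσr⟩ := exists_between hρr
  have hopen : IsOpen {x | gauge B (x - c) < σ} :=
    isOpen_lt (hB.continuous_gauge.comp (continuous_id.sub continuous_const)) continuous_const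
  filter_upwards [(NonemptyCompacts.isOpen_subsets_of_isOpen hopen).mem_nhds
    (show (K : Set (V n)) ⊆ _ from fun x hx => (hc x hx).trans_lt hρσ)] with L hL
  exact (circum_le hB (hρ.trans hρσ) c fun x hx => (hL hx).le).trans_lt hσr

/-- Among the compact subsets of `B` of diameter at most one, some set has maximal
circumradius. -/
lemma exists_isMaxOn_circum (hB : IsSymUnitBall B) :
    ∃ K : Set (V n), K.Nonempty ∧ (∀ x ∈ K, ∀ y ∈ K, gauge B (x - y) ≤ 1) ∧
      ∀ L : Set (V n), IsCompact L → L.Nonempty → L ⊆ B →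
        (∀ x ∈ L, ∀ y ∈ L, gauge B (x - y) ≤ 1) → circum B L ≤ circum B K := by
  let F : Set (V n × V n) := {p | gauge B (p.1 - p.2) ≤ 1}
  have hF : IsClosed F :=
    isClosed_le (hB.continuous_gauge.comp (continuous_fst.sub continuous_snd)) continuous_const
  have hclosed : IsClosed {K : NonemptyCompacts (V n) | ((K ×ˢ K : NonemptyCompacts _) :
      Set (V n × V n)) ⊆ F} :=
    (NonemptyCompacts.isClosed_subsets_of_isClosed hF).preimage
      (NonemptyCompacts.continuous_prod.comp (continuous_id.prodMk continuous_id))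
  have hcompact : IsCompact {K : NonemptyCompacts (V n) | (K : Set (V n)) ⊆ B} :=
    NonemptyCompacts.isClosedEmbedding_toCompacts.isCompact_preimage
      (Compacts.isCompact_subsets_of_isCompact hB.1.2.1)
  obtain ⟨K, hK, hmax⟩ := UpperSemicontinuousOn.exists_isMaxOn
    (s := {K : NonemptyCompacts (V n) | (K : Set (V n)) ⊆ B} ∩
      {K | ((K ×ˢ K : NonemptyCompacts _) : Set (V n × V n)) ⊆ F})
    ⟨{0}, by simpa using mem_of_mem_nhds hB.mem_nhds_zero, by simp [F]⟩
    (hcompact.inter_right hclosed) ((upperSemicontinuous_circum hB).upperSemicontinuousOn _)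
  refine ⟨K, K.nonempty, fun x hx y hy => hK.2 (show (x, y) ∈ _ from ⟨hx, hy⟩), ?_⟩
  intro L hL hne hLB hLd
  exact hmax (a := ⟨⟨L, hL⟩, hne⟩) ⟨hLB, fun p hp => hLd p.1 hp.1 p.2 hp.2⟩

/-- A nonempty compact set of diameter at most one lies in a ball of radius less than one. -/
lemma exists_radius_lt_one (hB : IsSymUnitBall B) (hK : IsCompact K) (hne : K.Nonempty)
    (hd : ∀ x ∈ K, ∀ y ∈ K, gauge B (x - y) ≤ 1) :
    ∃ c, ∃ ρ < 1, ∀ x ∈ K, gauge B (c - x) ≤ ρ := by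
  obtain ⟨t, htK, hcover⟩ := hK.elim_nhds_subcover (fun y => {x | gauge B (y - x) < 1 / 2})
    fun y _ => (isOpen_lt (hB.continuous_gauge.comp (continuous_const.sub continuous_id))
      continuous_const).mem_nhds (by simp)
  have htne : t.Nonempty := by
    obtain ⟨x, hx⟩ := hne
    obtain ⟨y, hy, -⟩ := mem_iUnion₂.1 (hcover hx)
    exact ⟨y, hy⟩
  have hN : (0 : ℝ) < t.card := by exact_mod_cast htne.card_pos
  have hN' : (t.card : ℝ)⁻¹ > 0 := inv_pos.2 hN
  refine ⟨(t.card : ℝ)⁻¹ • ∑ y ∈ t, y, (t.card : ℝ)⁻¹ * (t.card - 1 / 2), ?_, fun x hx => ?_⟩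
  · rw [inv_mul_lt_iff₀ hN]
    linarith
  · obtain ⟨z, hz, hzx⟩ := mem_iUnion₂.1 (hcover hx)
    have hsub : (t.card : ℝ)⁻¹ • ∑ y ∈ t, y - x = (t.card : ℝ)⁻¹ • ∑ y ∈ t, (y - x) := by
      rw [Finset.sum_sub_distrib, Finset.sum_const, smul_sub, ← Nat.cast_smul_eq_nsmul ℝ,
        inv_smul_smul₀ hN.ne']
    rw [hsub, gauge_smul_of_nonneg hN'.le, smul_eq_mul]
    refine mul_le_mul_of_nonneg_left ?_ hN'.le
    refine (gauge_sum_le hB.1.1 (absorbent_nhds_zero hB.mem_nhds_zero) t _).trans ?_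
    have hle : ∑ y ∈ t.erase z, gauge B (y - x) ≤ ∑ _y ∈ t.erase z, (1 : ℝ) :=
      Finset.sum_le_sum fun y hy => hd y (htK y (Finset.mem_of_mem_erase hy)) x hx
    rw [Finset.sum_const, nsmul_one, Finset.card_erase_of_mem hz,
      Nat.cast_sub htne.card_pos, Nat.cast_one] at hle
    rw [← Finset.add_sum_erase t _ hz]
    have hzx' : gauge B (z - x) < 1 / 2 := hzx
    linarith

/-- Every nonempty set of diameter at most one extends to a complete body of diameter at
most one. -/
lemma exists_isCompleteBody_superset (hB : IsSymUnitBall B) (hne : K.Nonempty)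
    (hd : ∀ x ∈ K, ∀ y ∈ K, gauge B (x - y) ≤ 1) :
    ∃ M, K ⊆ M ∧ IsCompleteBody B M ∧ mdiam B M ≤ 1 := by
  obtain ⟨M, hKM, hM⟩ := zorn_subset_nonempty
    {S : Set (V n) | ∀ x ∈ S, ∀ y ∈ S, gauge B (x - y) ≤ 1} (by
      intro c hc hchain _
      refine ⟨⋃₀ c, ?_, fun s => subset_sUnion_of_mem⟩
      rintro x ⟨s, hs, hxs⟩ y ⟨t, ht, hyt⟩
      obtain h | h := hchain.total hs ht
      · exact hc ht x (h hxs) y hyt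
      · exact hc hs x hxs y (h hyt)) K hd
  have hMd : ∀ x ∈ M, ∀ y ∈ M, gauge B (x - y) ≤ 1 := hM.prop
  have hmem : ∀ x, (∀ y ∈ M, gauge B (x - y) ≤ 1) → x ∈ M := by
    intro x hx
    refine hM.le_of_ge (y := insert x M) ?_ (subset_insert x M) (mem_insert x M)
    rintro y (rfl | hy) z (rfl | hz)
    · simp
    · exact hx z hz
    · rw [hB.gauge_sub_comm]
      exact hx y hy
    · exact hMd y hy z hz
  have hMeq : M = ⋂ y ∈ M, {x | gauge B (x - y) ≤ 1} := by
    ext x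
    simp only [mem_iInter, mem_ofPred_eq]
    exact ⟨fun hx y hy => hMd x hx y hy, hmem x⟩
  have hMne : M.Nonempty := hne.mono hKM
  have hconvex : Convex ℝ M := by
    rw [hMeq]
    exact convex_iInter₂ fun y _ => hB.convex_setOf_gauge_sub_le y 1
  have hclosed : IsClosed M := by
    rw [hMeq]
    exact isClosed_biInter fun y _ => hB.isClosed_setOf_gauge_sub_le y 1
  have hcompact : IsCompact M := by
    obtain ⟨y, hy⟩ := hMne
    exact (hB.isCompact_setOf_gauge_sub_le_one y).of_isClosed_subset hclosed
      fun x hx => hMd x hx y hy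
  have hdiam : mdiam B M ≤ 1 := mdiam_le zero_le_one hMd
  refine ⟨M, hKM, ⟨⟨hconvex, hcompact, ?_⟩, fun x hx => ?_⟩, hdiam⟩
  · obtain ⟨c, ρ, hρ, hc⟩ := exists_radius_lt_one hB hcompact hMne hMd
    have hopen : IsOpen {x | gauge B (x - c) < 1 - ρ} :=
      isOpen_lt (hB.continuous_gauge.comp (continuous_id.sub continuous_const)) continuous_const
    refine ⟨c, interior_maximal (fun x hx => hmem x fun y hy => ?_) hopen (by simpa using hρ)⟩
    have hx' : gauge B (x - c) < 1 - ρ := hx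
    linarith [hB.gauge_sub_le x c y, hc y hy]
  · obtain ⟨y, hy, hxy⟩ : ∃ y ∈ M, 1 < gauge B (x - y) := by
      by_contra! h
      exact hx (hmem x h)
    exact (hdiam.trans_lt hxy).trans_le (gauge_sub_le_mdiam hB
      (hcompact.union isCompact_singleton) (.inr rfl) (.inl hy))

/-- Rescaling a convex body to diameter one bounds its Jung ratio by the circumradius of a
compact subset of `B` of diameter at most one. -/
lemma exists_jungRatio_le_circum (hB : IsSymUnitBall B) (hK : IsCompact K) (hne : K.Nonempty) :
    ∃ L : Set (V n), IsCompact L ∧ L.Nonempty ∧ L ⊆ B ∧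
      (∀ x ∈ L, ∀ y ∈ L, gauge B (x - y) ≤ 1) ∧ jungRatio B K ≤ circum B L := by
  obtain ⟨a, ha⟩ := hne
  obtain hD | hD := (mdiam_nonneg B K).eq_or_lt
  · refine ⟨{0}, isCompact_singleton, singleton_nonempty 0, ?_, by simp, ?_⟩
    · simpa using mem_of_mem_nhds hB.mem_nhds_zero
    · rw [jungRatio, ← hD, div_zero]
      exact circum_nonneg _ _
  set D := mdiam B K
  have hscale : ∀ x y : V n, gauge B (D⁻¹ • (x - a) - y) = D⁻¹ * gauge B (x - (a + D • y)) := by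
    intro x y
    rw [← smul_eq_mul, ← gauge_smul_of_nonneg (inv_nonneg.2 hD.le), ← sub_sub, smul_sub _ (x - a),
      inv_smul_smul₀ hD.ne']
  have hLd : ∀ x ∈ K, ∀ y ∈ K, gauge B (D⁻¹ • (x - a) - D⁻¹ • (y - a)) ≤ 1 := by
    intro x hx y hy
    rw [hscale, smul_inv_smul₀ hD.ne', add_sub_cancel, inv_mul_le_one₀ hD]
    exact gauge_sub_le_mdiam hB hK hx hy
  have hL : IsCompact ((fun x => D⁻¹ • (x - a)) '' K) := hK.image (by fun_prop)
  refine ⟨(fun x => D⁻¹ • (x - a)) '' K, hL, ⟨_, a, ha, rfl⟩, ?_, ?_, ?_⟩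
  · rintro _ ⟨x, hx, rfl⟩
    rw [← hB.gauge_le_one_iff]
    simpa using hLd x hx a ha
  · rintro _ ⟨x, hx, rfl⟩ _ ⟨y, hy, rfl⟩
    exact hLd x hx y hy
  · refine le_of_forall_gt_imp_ge_of_dense fun r hr => ?_
    obtain ⟨ρ, hρ, hρr, c, hc⟩ := exists_of_circum_lt hB hL hr
    refine le_trans ?_ hρr.le
    rw [jungRatio, div_le_iff₀ hD]
    refine circum_le hB (mul_pos hρ hD) (a + D • c) fun x hx => ?_
    have h := hc _ ⟨x, hx, rfl⟩
    rwa [hscale, inv_mul_le_iff₀ hD, mul_comm] at h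

lemma circum_le_jungRatio (hB : IsSymUnitBall B) (hK : IsCompact K) (hne : K.Nonempty)
    (hd : mdiam B K ≤ 1) : circum B K ≤ jungRatio B K := by
  obtain hD | hD := (mdiam_nonneg B K).eq_or_lt
  · rw [jungRatio, ← hD, div_zero, hD]
    exact circum_le_mdiam hB hK hne
  · rw [jungRatio, le_div_iff₀ hD]
    exact mul_le_of_le_one_right (circum_nonneg B K) hd

end Radius

/-- The Jung constant is attained by a complete body. -/
theorem stmt5 {n : ℕ} (B : Set (V n)) (hB : IsSymUnitBall B) :
    ∃ K : Set (V n), IsCompleteBody B K ∧ jungRatio B K = jungConst B ∧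
      ∀ L : Set (V n), IsCompleteBody B L → jungRatio B L ≤ jungRatio B K := by
  obtain ⟨K, hne, hd, hmax⟩ := exists_isMaxOn_circum hB
  obtain ⟨M, hKM, hM, hMd⟩ := exists_isCompleteBody_superset hB hne hd
  have hle : ∀ L : Set (V n), IsConvexBody L → jungRatio B L ≤ jungRatio B M := by
    intro L hL
    obtain ⟨L', hc, hne', hsub, hd', hr⟩ :=
      exists_jungRatio_le_circum hB hL.2.1 (hL.2.2.mono interior_subset)
    exact hr.trans <| (hmax L' hc hne' hsub hd').trans <|
      (circum_mono hB hM.1.2.1 hKM).trans <|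
        circum_le_jungRatio hB hM.1.2.1 (hne.mono hKM) hMd
  refine ⟨M, hM, ?_, fun L hL => hle L hL.1⟩
  have hgreatest : IsGreatest {j : ℝ | ∃ K : Set (V n), IsConvexBody K ∧ j = jungRatio B K}
      (jungRatio B M) := by
    refine ⟨⟨M, hM.1, rfl⟩, ?_⟩
    rintro _ ⟨L, hL, rfl⟩
    exact hle L hL
  exact hgreatest.csSup_eq.symm
end

section
/- In Euclidean space E^n, the maximal Minkowski asymmetry over complete bodies (equivalently, over bodies of constant width) equals (n + √(2n(n+1)))/(n+2). -/
open Set Pointwise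

section Variance

variable {ι E : Type*} [Fintype ι] [NormedAddCommGroup E] [InnerProductSpace ℝ E]

/-- The variance of a family of points `p` with weights `w`. -/
noncomputable def weightedVariance (p : ι → E) (w : ι → ℝ) : ℝ :=
  ∑ i, w i * ‖p i‖ ^ 2 - ‖∑ i, w i • p i‖ ^ 2

theorem sum_sum_mul_dist_sq (p : ι → E) {w : ι → ℝ} (hw : ∑ i, w i = 1) :
    ∑ i, ∑ j, w i * w j * dist (p i) (p j) ^ 2 = 2 * weightedVariance p w := by
  have h1 : ∀ i j, w i * w j * dist (p i) (p j) ^ 2 =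
      (w i * ‖p i‖ ^ 2) * w j + w i * (w j * ‖p j‖ ^ 2)
        - 2 * inner ℝ (w i • p i) (w j • p j) := by
    intro i j
    rw [dist_eq_norm, norm_sub_sq_real, real_inner_smul_left, real_inner_smul_right]
    ring
  simp_rw [h1, Finset.sum_sub_distrib, Finset.sum_add_distrib, ← Finset.mul_sum, ← inner_sum,
    ← sum_inner, ← Finset.sum_mul, hw, real_inner_self_eq_norm_sq, weightedVariance]
  ring

theorem weightedVariance_le [Nonempty ι] (p : ι → E) {w : ι → ℝ} (hw : w ∈ stdSimplex ℝ ι)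
    {D : ℝ} (hp : ∀ i j, dist (p i) (p j) ≤ D) :
    weightedVariance p w ≤ D ^ 2 / 2 * (1 - 1 / Fintype.card ι) := by
  classical
  have key : ∀ i j, w i * w j * dist (p i) (p j) ^ 2 ≤
      D ^ 2 * (w i * w j - if i = j then w i ^ 2 else 0) := by
    intro i j
    split_ifs with h
    · subst h
      simp [sq]
    · have := pow_le_pow_left₀ dist_nonneg (hp i j) 2
      nlinarith [mul_nonneg (hw.1 i) (hw.1 j)]
  have h2 := Finset.sum_le_sum fun i (_ : i ∈ Finset.univ) =>
    Finset.sum_le_sum fun j (_ : j ∈ Finset.univ) => key i j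
  rw [sum_sum_mul_dist_sq p hw.2] at h2
  simp_rw [← Finset.mul_sum, Finset.sum_sub_distrib, ← Finset.mul_sum, hw.2, mul_one, hw.2] at h2
  simp only [Finset.sum_ite_eq, Finset.mem_univ, if_true] at h2
  have h3 := sq_sum_le_card_mul_sum_sq (s := Finset.univ) (f := w)
  rw [hw.2, Finset.card_univ, one_pow] at h3
  have hc : (0 : ℝ) < Fintype.card ι := by exact_mod_cast Fintype.card_pos
  have h4 : 1 / (Fintype.card ι : ℝ) ≤ ∑ i, w i ^ 2 := by
    rw [div_le_iff₀ hc]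
    linarith
  nlinarith [sq_nonneg D]

theorem weightedVariance_mix [DecidableEq ι] (p : ι → E) (w : ι → ℝ) (k : ι) (t : ℝ) :
    weightedVariance p ((1 - t) • w + t • Pi.single k 1) =
      (1 - t) * weightedVariance p w + t * (1 - t) * dist (p k) (∑ i, w i • p i) ^ 2 := by
  have h1 : ∑ i, ((1 - t) • w + t • Pi.single k 1 : ι → ℝ) i * ‖p i‖ ^ 2 =
      (1 - t) * ∑ i, w i * ‖p i‖ ^ 2 + t * ‖p k‖ ^ 2 := by
    simp [add_mul, Finset.sum_add_distrib, Finset.mul_sum, Pi.single_apply, mul_assoc]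
  have h2 : ∑ i, ((1 - t) • w + t • Pi.single k 1 : ι → ℝ) i • p i =
      (1 - t) • ∑ i, w i • p i + t • p k := by
    simp [add_smul, Finset.sum_add_distrib, Finset.smul_sum, Pi.single_apply, mul_smul]
  rw [weightedVariance, h1, h2, weightedVariance, dist_eq_norm, norm_sub_sq_real,
    norm_add_sq_real, norm_smul, norm_smul, mul_pow, mul_pow, Real.norm_eq_abs, Real.norm_eq_abs,
    sq_abs, sq_abs, real_inner_smul_left, real_inner_smul_right, real_inner_comm]
  ring

/-- The barycenter for weights of maximal variance is the center of an enclosing ball. -/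
theorem exists_center_of_finite [Nonempty ι] (p : ι → E) {D : ℝ}
    (hp : ∀ i j, dist (p i) (p j) ≤ D) :
    ∃ c, ∀ i, dist (p i) c ^ 2 ≤ D ^ 2 / 2 * (1 - 1 / Fintype.card ι) := by
  classical
  have hcont : Continuous (weightedVariance p) := by
    unfold weightedVariance
    fun_prop
  obtain ⟨w, hw, hmax⟩ := (isCompact_stdSimplex ℝ ι).exists_isMaxOn
    ⟨_, single_mem_stdSimplex ℝ (Classical.arbitrary ι)⟩ hcont.continuousOn
  refine ⟨∑ i, w i • p i, fun k => le_trans ?_ (weightedVariance_le p hw hp)⟩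
  set d := dist (p k) (∑ i, w i • p i) ^ 2
  have step : ∀ t ∈ Ioc (0 : ℝ) 1, (1 - t) * d ≤ weightedVariance p w := by
    intro t ht
    have hmem := (convex_stdSimplex ℝ ι) hw (single_mem_stdSimplex ℝ k)
      (sub_nonneg.2 ht.2) ht.1.le (by ring)
    have h := hmax hmem
    simp only [mem_ofPred_eq, weightedVariance_mix] at h
    nlinarith [ht.1]
  have hlim : Filter.Tendsto (fun t : ℝ => (1 - t) * d) (nhdsWithin 0 (Ioi 0)) (nhds d) := by
    have : Continuous fun t : ℝ => (1 - t) * d := by fun_prop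
    simpa using (this.tendsto 0).mono_left nhdsWithin_le_nhds
  refine le_of_tendsto hlim ?_
  filter_upwards [Ioc_mem_nhdsGT (zero_lt_one' ℝ)] with t ht using step t ht

end Variance

/-- The Jung constant of the `n`-dimensional Euclidean space. -/
noncomputable def euclJung (n : ℕ) : ℝ := Real.sqrt (n / (2 * (n + 1)))

theorem euclJung_nonneg (n : ℕ) : 0 ≤ euclJung n := Real.sqrt_nonneg _

theorem euclJung_sq (n : ℕ) : euclJung n ^ 2 = n / (2 * (n + 1)) :=
  Real.sq_sqrt (by positivity)

theorem euclJung_lt_one (n : ℕ) : euclJung n < 1 := by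
  have h := euclJung_sq n
  have : (n : ℝ) / (2 * (n + 1)) < 1 := by
    rw [div_lt_one (by positivity)]
    linarith [(Nat.cast_nonneg n : (0 : ℝ) ≤ n)]
  nlinarith [euclJung_nonneg n]

theorem half_le_euclJung {n : ℕ} (hn : 1 ≤ n) : 1 / 2 ≤ euclJung n := by
  refine Real.le_sqrt_of_sq_le ?_
  have : (1 : ℝ) ≤ n := by exact_mod_cast hn
  rw [le_div_iff₀ (by positivity)]
  linarith

theorem euclJung_div_one_sub (n : ℕ) :
    euclJung n / (1 - euclJung n) = (n + Real.sqrt (2 * n * (n + 1))) / (n + 2) := by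
  have h1 : Real.sqrt (2 * n * (n + 1)) = 2 * (n + 1) * euclJung n := by
    rw [Real.sqrt_eq_iff_mul_self_eq (by positivity)
      (mul_nonneg (by positivity) (euclJung_nonneg n))]
    have := euclJung_sq n
    field_simp at this
    linear_combination -2 * ((n : ℝ) + 1) * this
  have h2 := sub_pos.2 (euclJung_lt_one n)
  have h3 := euclJung_sq n
  field_simp at h3
  rw [h1, div_eq_div_iff h2.ne' (by positivity)]
  linear_combination h3

/-- The theorem of Jung on enclosing balls, in Euclidean space. -/
theorem jung_theorem {n : ℕ} {K : Set (V n)} {D : ℝ} (hD : 0 ≤ D)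
    (hK : ∀ x ∈ K, ∀ y ∈ K, dist x y ≤ D) :
    ∃ c, ∀ x ∈ K, dist x c ≤ euclJung n * D := by
  have h := Convex.helly_theorem_compact' (𝕜 := ℝ)
    (F := fun x : K => Metric.closedBall (x : V n) (euclJung n * D))
    (fun x => convex_closedBall _ _) (fun x => isCompact_closedBall _ _) ?_
  · obtain ⟨c, hc⟩ := h
    refine ⟨c, fun x hx => ?_⟩
    rw [dist_comm]
    exact mem_iInter.1 hc ⟨x, hx⟩
  · intro I hI
    rw [finrank_euclideanSpace_fin] at hI
    rcases I.eq_empty_or_nonempty with rfl | hne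
    · simp
    · have := hne.to_subtype
      obtain ⟨c, hc⟩ := exists_center_of_finite (fun i : I => ((i : K) : V n))
        fun i j => hK _ i.1.2 _ j.1.2
      refine ⟨c, mem_iInter₂.2 fun i hi => ?_⟩
      rw [Metric.mem_closedBall, dist_comm]
      refine le_of_sq_le_sq ?_ (mul_nonneg (euclJung_nonneg n) hD)
      refine (hc ⟨i, hi⟩).trans ?_
      rw [mul_pow, euclJung_sq, Fintype.card_coe]
      have h1 : (0 : ℝ) < I.card := by exact_mod_cast hne.card_pos
      have h2 : (I.card : ℝ) ≤ n + 1 := by exact_mod_cast hI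
      have h3 := one_div_le_one_div_of_le h1 h2
      have h4 : (n : ℝ) / (2 * (n + 1)) = 1 / 2 * (1 - 1 / (n + 1)) := by
        field_simp
        ring
      rw [h4]
      nlinarith [sq_nonneg D]

theorem mdiam_euclBall {n : ℕ} {K : Set (V n)} (hK : Bornology.IsBounded K) :
    mdiam (euclBall n) K = Metric.diam K := by
  have hg : ∀ x y : V n, gauge (euclBall n) (x - y) = dist x y := fun x y => by
    rw [euclBall, gauge_closedBall zero_le_one, div_one, dist_eq_norm]
  simp only [mdiam, hg]
  refine le_antisymm ?_ ?_
  · refine Real.sSup_le ?_ Metric.diam_nonneg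
    rintro _ ⟨x, hx, y, hy, rfl⟩
    exact Metric.dist_le_diam_of_mem hK hx hy
  · refine Metric.diam_le_of_forall_dist_le (Real.sSup_nonneg ?_) fun x hx y hy =>
      le_csSup ⟨Metric.diam K, ?_⟩ ⟨x, hx, y, hy, rfl⟩
    · rintro _ ⟨x, -, y, -, rfl⟩
      exact dist_nonneg
    · rintro _ ⟨x, hx, y, hy, rfl⟩
      exact Metric.dist_le_diam_of_mem hK hx hy

theorem isCompleteBody_euclBall_iff {n : ℕ} {K : Set (V n)} :
    IsCompleteBody (euclBall n) K ↔
      IsConvexBody K ∧ ∀ x, (∀ y ∈ K, dist x y ≤ Metric.diam K) → x ∈ K := by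
  refine and_congr_right fun hK => forall_congr' fun x => ?_
  have hb := hK.2.1.isBounded
  have hb' : Bornology.IsBounded (K ∪ {x}) := hb.union Bornology.isBounded_singleton
  rw [mdiam_euclBall hb, mdiam_euclBall hb', ← not_imp_not, not_not, not_lt]
  refine imp_congr_left ⟨fun h y hy => ?_, fun h => ?_⟩
  · exact (Metric.dist_le_diam_of_mem hb' (by simp) (by simp [hy])).trans h
  · refine Metric.diam_le_of_forall_dist_le Metric.diam_nonneg ?_
    rintro y (hy | rfl) z (hz | rfl)
    · exact Metric.dist_le_diam_of_mem hb hy hz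
    · exact dist_comm y z ▸ h y hy
    · exact h z hz
    · simp [Metric.diam_nonneg]

/-- A complete body containing a given set of diameter at most `D` exists. -/
theorem exists_isCompleteBody {n : ℕ} {T : Set (V n)} {D : ℝ} (hD : 0 ≤ D)
    (hT : ∀ x ∈ T, ∀ y ∈ T, dist x y ≤ D) (hint : (interior T).Nonempty) :
    ∃ K, T ⊆ K ∧ IsCompleteBody (euclBall n) K ∧ ∀ x ∈ K, ∀ y ∈ K, dist x y ≤ D := by
  obtain ⟨K, hTK, hK⟩ := zorn_subset_nonempty
    {A : Set (V n) | ∀ x ∈ A, ∀ y ∈ A, dist x y ≤ D} (fun c hc hchain _ => by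
      refine ⟨⋃₀ c, ?_, fun s hs => subset_sUnion_of_mem hs⟩
      rintro x ⟨s, hs, hx⟩ y ⟨t, ht, hy⟩
      rcases hchain.total hs ht with h | h
      · exact hc ht x (h hx) y hy
      · exact hc hs x hx y (h hy)) T hT
  have hKD : ∀ x ∈ K, ∀ y ∈ K, dist x y ≤ D := hK.prop
  have hb : Bornology.IsBounded K := Metric.isBounded_iff.2 ⟨D, fun x hx y hy => hKD x hx y hy⟩
  have hdiam : Metric.diam K ≤ D := Metric.diam_le_of_forall_dist_le hD hKD
  have hmax : ∀ x, (∀ y ∈ K, dist x y ≤ D) → x ∈ K := fun x hx => by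
    have hmem : insert x K ∈ {A : Set (V n) | ∀ x ∈ A, ∀ y ∈ A, dist x y ≤ D} := by
      rintro y (rfl | hy) z (rfl | hz)
      · simpa using hD
      · exact hx z hz
      · exact dist_comm y z ▸ hx y hy
      · exact hKD y hy z hz
    exact hK.le_of_ge hmem (subset_insert x K) (mem_insert x K)
  have hinter : K = ⋂ y ∈ K, Metric.closedBall y D := by
    ext x
    simp only [mem_iInter₂, Metric.mem_closedBall]
    exact ⟨fun hx y hy => hKD x hx y hy, hmax x⟩
  refine ⟨K, hTK, isCompleteBody_euclBall_iff.2 ⟨⟨?_, ?_, hint.mono (interior_mono hTK)⟩,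
    fun x hx => hmax x fun y hy => (hx y hy).trans hdiam⟩, hKD⟩
  · rw [hinter]
    exact convex_iInter₂ fun y _ => convex_closedBall y D
  · refine Metric.isCompact_of_isClosed_isBounded ?_ hb
    rw [hinter]
    exact isClosed_biInter fun y _ => Metric.isClosed_closedBall

theorem IsConvexBody.diam_pos {n : ℕ} (hn : 1 ≤ n) {K : Set (V n)} (hK : IsConvexBody K) :
    0 < Metric.diam K := by
  have : Nonempty (Fin n) := ⟨⟨0, hn⟩⟩
  obtain ⟨x, hx⟩ := hK.2.2
  have hinf := infinite_of_mem_nhds x (mem_interior_iff_mem_nhds.1 hx)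
  obtain ⟨a, ha, b, hb, hab⟩ := hinf.nontrivial
  exact (dist_pos.2 hab).trans_le (Metric.dist_le_diam_of_mem hK.2.1.isBounded ha hb)

theorem asym_le_of_isCompleteBody {n : ℕ} (hn : 1 ≤ n) {K : Set (V n)}
    (hK : IsCompleteBody (euclBall n) K) : asym K ≤ euclJung n / (1 - euclJung n) := by
  rw [isCompleteBody_euclBall_iff] at hK
  have hD := hK.1.diam_pos hn
  set D := Metric.diam K
  have hj0 : 0 < euclJung n := lt_of_lt_of_le (by norm_num) (half_le_euclJung hn)
  have hj1 := sub_pos.2 (euclJung_lt_one n)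
  have hs := div_pos hj0 hj1
  obtain ⟨c, hc⟩ := jung_theorem Metric.diam_nonneg
    fun x hx y hy => Metric.dist_le_diam_of_mem hK.1.2.1.isBounded hx hy
  set s := euclJung n / (1 - euclJung n)
  refine csInf_le ⟨0, fun ρ hρ => hρ.1.le⟩ ⟨hs, -c - s • c, fun x hx => ?_⟩
  have hmem : c + s⁻¹ • (x + c) ∈ K := by
    refine hK.2 _ fun y hy => ?_
    have h1 : dist (c + s⁻¹ • (x + c)) c ≤ (1 - euclJung n) * D := by
      have h2 := hc _ hx
      rw [dist_eq_norm, ← norm_neg, neg_sub, sub_neg_eq_add, add_comm] at h2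
      rw [dist_eq_norm, add_sub_cancel_left, norm_smul, norm_inv, Real.norm_of_nonneg hs.le,
        inv_div, div_mul_eq_mul_div, div_le_iff₀ hj0]
      nlinarith
    have h3 := hc y hy
    have h4 := dist_triangle_right (c + s⁻¹ • (x + c)) y c
    linarith
  refine ⟨s • (c + s⁻¹ • (x + c)), smul_mem_smul_set hmem, ?_⟩
  simp only [vadd_eq_add, smul_add, smul_inv_smul₀ hs.ne']
  abel

/-- The vertices of a regular simplex of edge length `√2` centered at the origin. -/
theorem exists_regular_simplex (n : ℕ) : ∃ w : Fin (n + 1) → V n, ∑ i, w i = 0 ∧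
    ∀ i j, inner ℝ (w i) (w j) = (if i = j then 1 else 0) - 1 / ((n : ℝ) + 1) := by
  let o : EuclideanSpace ℝ (Fin (n + 1)) := WithLp.toLp 2 fun _ => 1
  have ho : o ≠ 0 := fun h => by
    have := congrArg (fun v : EuclideanSpace ℝ (Fin (n + 1)) => v 0) h
    simp [o] at this
  have : Fact (Module.finrank ℝ (EuclideanSpace ℝ (Fin (n + 1))) = n + 1) := ⟨by simp⟩
  let b := OrthonormalBasis.fromOrthogonalSpanSingleton (𝕜 := ℝ) n ho
  let e : Fin (n + 1) → EuclideanSpace ℝ (Fin (n + 1)) := fun i =>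
    EuclideanSpace.single i 1 - (1 / ((n : ℝ) + 1)) • o
  have hoo : inner ℝ o o = (n : ℝ) + 1 := by
    rw [PiLp.inner_apply]
    simp [o]
  have hos : ∀ i, inner ℝ o (EuclideanSpace.single i (1 : ℝ)) = 1 := fun i => by
    simp [o, EuclideanSpace.inner_single_right]
  have hmem : ∀ i, e i ∈ (Submodule.span ℝ {o})ᗮ := fun i => by
    rw [Submodule.mem_orthogonal_singleton_iff_inner_right, inner_sub_right, hos,
      real_inner_smul_right, hoo]
    field_simp
    ring
  refine ⟨fun i => b.repr ⟨e i, hmem i⟩, ?_, fun i j => ?_⟩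
  · rw [← map_sum]
    convert map_zero b.repr
    ext k
    simp only [Submodule.coe_sum, e, Finset.sum_sub_distrib]
    simp [o, Pi.single_apply]
    field_simp
    ring
  · rw [LinearIsometryEquiv.inner_map_map, Submodule.coe_inner]
    simp only [e, inner_sub_left, inner_sub_right, real_inner_smul_left, real_inner_smul_right,
      hoo, hos, EuclideanSpace.inner_single_left]
    have : EuclideanSpace.single j (1 : ℝ) i = if i = j then 1 else 0 := by
      simp
    rw [this]
    simp
    field_simp
    ring

theorem exists_isCompleteBody_le_asym {n : ℕ} (hn : 1 ≤ n) :
    ∃ K : Set (V n), IsCompleteBody (euclBall n) K ∧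
      euclJung n / (1 - euclJung n) ≤ asym K := by
  obtain ⟨w, hw0, hw⟩ := exists_regular_simplex n
  set D := Real.sqrt 2 with hDdef
  have hD : 0 < D := by positivity
  have hD2 : D ^ 2 = 2 := Real.sq_sqrt (by norm_num)
  set R := euclJung n * D with hRdef
  have hjhalf := half_le_euclJung hn
  have hj1 := euclJung_lt_one n
  have hRD : R < D := by nlinarith
  have hDR : D ≤ 2 * R := by nlinarith
  have hR : 0 < R := by linarith
  have hR2 : R ^ 2 = 1 - 1 / ((n : ℝ) + 1) := by
    rw [hRdef, mul_pow, hD2, euclJung_sq]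
    field_simp
    ring
  have hnorm : ∀ i, ‖w i‖ = R := fun i => by
    rw [← sq_eq_sq₀ (norm_nonneg _) hR.le, ← real_inner_self_eq_norm_sq, hw, if_pos rfl, hR2]
  have hdist : ∀ i j, dist (w i) (w j) ≤ D := fun i j => by
    refine le_of_sq_le_sq ?_ hD.le
    rw [dist_eq_norm, norm_sub_sq_real, hnorm, hnorm, hw, hD2, hR2]
    have : 0 ≤ 1 / ((n : ℝ) + 1) := by positivity
    split_ifs <;> linarith
  have hT : ∀ x ∈ range w ∪ Metric.closedBall 0 (D - R),
      ∀ y ∈ range w ∪ Metric.closedBall 0 (D - R), dist x y ≤ D := by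
    rintro x (⟨i, rfl⟩ | hx) y (⟨j, rfl⟩ | hy)
    · exact hdist i j
    · have h1 := mem_closedBall_zero_iff.1 hy
      have h2 := dist_le_norm_add_norm (w i) y
      rw [hnorm] at h2
      linarith
    · have h1 := mem_closedBall_zero_iff.1 hx
      have h2 := dist_le_norm_add_norm x (w j)
      rw [hnorm] at h2
      linarith
    · have h1 := mem_closedBall_zero_iff.1 hx
      have h3 := mem_closedBall_zero_iff.1 hy
      have h2 := dist_le_norm_add_norm x y
      linarith
  obtain ⟨K, hTK, hK, hKD⟩ := exists_isCompleteBody hD.le hT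
    ⟨0, mem_interior_iff_mem_nhds.2 (Filter.mem_of_superset
      (Metric.closedBall_mem_nhds 0 (sub_pos.2 hRD)) subset_union_right)⟩
  have hwK : ∀ i, w i ∈ K := fun i => hTK (Or.inl (mem_range_self i))
  have hsupp : ∀ i, ∀ x ∈ K, -inner ℝ x (w i) ≤ R * (D - R) := fun i x hx => by
    have h1 := real_inner_le_norm (w i - x) (w i)
    rw [← dist_eq_norm, inner_sub_left, real_inner_self_eq_norm_sq, hnorm] at h1
    nlinarith [hKD _ (hwK i) x hx]
  have hlower : ∀ ρ : ℝ, 0 < ρ → ∀ c : V n, -K ⊆ c +ᵥ ρ • K → R ≤ ρ * (D - R) := by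
    intro ρ hρ c hc
    have hi : ∀ i, R ^ 2 ≤ -inner ℝ c (w i) + ρ * (R * (D - R)) := fun i => by
      have hmem : -w i ∈ -K := by simpa using hwK i
      obtain ⟨_, ⟨x, hx, rfl⟩, hcx⟩ := hc hmem
      simp only [vadd_eq_add] at hcx
      have h1 := congrArg (fun v => inner ℝ v (w i)) hcx
      simp only [inner_add_left, real_inner_smul_left, inner_neg_left,
        real_inner_self_eq_norm_sq, hnorm] at h1
      nlinarith [mul_le_mul_of_nonneg_left (hsupp i x hx) hρ.le]
    have hsum := Finset.sum_le_sum fun i (_ : i ∈ Finset.univ) => hi i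
    rw [Finset.sum_add_distrib, Finset.sum_neg_distrib, ← inner_sum, hw0, inner_zero_right,
      neg_zero, zero_add, Finset.sum_const, Finset.sum_const, nsmul_eq_mul, nsmul_eq_mul,
      mul_le_mul_iff_right₀ (by simp; positivity)] at hsum
    nlinarith
  have hs : 0 < euclJung n / (1 - euclJung n) := div_pos (by linarith) (by linarith)
  refine ⟨K, hK, le_csInf ?_ ?_⟩
  · have h0 : (0 : V n) ∈ K := hTK (Or.inr (Metric.mem_closedBall_self (by linarith)))
    have hDR' : 0 < D - R := by linarith
    have hpos : 0 < D / (D - R) := div_pos hD hDR'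
    refine ⟨D / (D - R), hpos, 0, fun x hx => ?_⟩
    rw [zero_vadd, mem_smul_set_iff_inv_smul_mem₀ hpos.ne']
    refine hTK (Or.inr (mem_closedBall_zero_iff.2 ?_))
    have h1 := hKD _ hx 0 h0
    rw [dist_zero_right, norm_neg] at h1
    rw [norm_smul, norm_inv, Real.norm_of_nonneg hpos.le, inv_div, div_mul_eq_mul_div,
      div_le_iff₀ hD]
    nlinarith
  · rintro ρ ⟨hρ, c, hc⟩
    have h := hlower ρ hρ c hc
    rw [div_le_iff₀ (by linarith)]
    rw [hRdef] at h
    nlinarith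

/-- In Euclidean space, `s(Eⁿ) = (n + √(2n(n+1)))/(n+2)`. -/
theorem stmt11 {n : ℕ} (hn : 1 ≤ n) :
    asymConst (euclBall n) =
      (n + Real.sqrt (2 * n * (n + 1))) / (n + 2) := by
  rw [← euclJung_div_one_sub]
  obtain ⟨K, hK, hle⟩ := exists_isCompleteBody_le_asym hn
  refine IsGreatest.csSup_eq ⟨⟨K, hK, hle.antisymm (asym_le_of_isCompleteBody hn hK)⟩, ?_⟩
  rintro _ ⟨L, hL, rfl⟩
  exact asym_le_of_isCompleteBody hn hL
end

section
/- Every body of constant width K in Euclidean space E^n satisfies s(K) ≤ (n + √(2n(n+1)))/(n+2), with equality if K is a completion of a regular n-simplex. -/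
open Set Pointwise

section Jung

open Module

variable {E : Type*} [NormedAddCommGroup E] [InnerProductSpace ℝ E]

/-- The weighted sum of squared pairwise distances in terms of the first two moments. -/
lemma sum_sum_mul_norm_sub_sq {ι : Type*} [Fintype ι] (w : ι → ℝ) (x : ι → E) :
    ∑ i, ∑ j, w i * w j * ‖x i - x j‖ ^ 2 =
      2 * (∑ i, w i) * (∑ i, w i * ‖x i‖ ^ 2) - 2 * ‖∑ i, w i • x i‖ ^ 2 := by
  have h1 : ‖∑ i, w i • x i‖ ^ 2 = ∑ i, ∑ j, w i * w j * inner ℝ (x i) (x j) := by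
    rw [← real_inner_self_eq_norm_sq, sum_inner]
    refine Finset.sum_congr rfl fun i _ => ?_
    rw [inner_sum]
    refine Finset.sum_congr rfl fun j _ => ?_
    rw [real_inner_smul_left, real_inner_smul_right]
    ring
  have h2 : (∑ i, w i) * (∑ i, w i * ‖x i‖ ^ 2) = ∑ i, ∑ j, w i * w j * ‖x j‖ ^ 2 := by
    rw [Finset.sum_mul_sum]
    simp only [mul_assoc]
  have h3 : (∑ i, w i) * (∑ i, w i * ‖x i‖ ^ 2) = ∑ i, ∑ j, w i * w j * ‖x i‖ ^ 2 := by
    rw [h2, Finset.sum_comm]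
    simp only [mul_comm (w _) (w _)]
  have h4 : 2 * (∑ i, w i) * (∑ i, w i * ‖x i‖ ^ 2) - 2 * ‖∑ i, w i • x i‖ ^ 2 =
      (∑ i, w i) * (∑ i, w i * ‖x i‖ ^ 2) + (∑ i, w i) * (∑ i, w i * ‖x i‖ ^ 2)
        - 2 * ‖∑ i, w i • x i‖ ^ 2 := by ring
  rw [h4]
  nth_rewrite 1 [h2]
  rw [h3, h1, Finset.mul_sum, ← Finset.sum_add_distrib, ← Finset.sum_sub_distrib]
  refine Finset.sum_congr rfl fun i _ => ?_
  rw [Finset.mul_sum, ← Finset.sum_add_distrib, ← Finset.sum_sub_distrib]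
  refine Finset.sum_congr rfl fun j _ => ?_
  rw [norm_sub_sq_real]
  ring

/-- Some probability weights with barycentre `c` have a variance that dominates every squared
distance `‖x j - c‖ ^ 2`. -/
lemma exists_weights_norm_sub_sq_le_variance {ι : Type*} [Fintype ι] [Nonempty ι] (x : ι → E) :
    ∃ w ∈ stdSimplex ℝ ι, ∀ j, ‖x j - ∑ i, w i • x i‖ ^ 2 ≤
      (∑ i, w i * ‖x i‖ ^ 2) - ‖∑ i, w i • x i‖ ^ 2 := by
  classical
  have hne : (stdSimplex ℝ ι).Nonempty := ⟨_, single_mem_stdSimplex ℝ (Classical.arbitrary ι)⟩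
  obtain ⟨w, hw, hmax⟩ := (isCompact_stdSimplex ℝ ι).exists_isMaxOn hne
    (f := fun w => (∑ i, w i * ‖x i‖ ^ 2) - ‖∑ i, w i • x i‖ ^ 2) (by fun_prop)
  refine ⟨w, hw, fun j => ?_⟩
  set A := ∑ i, w i * ‖x i‖ ^ 2 with hA
  set c := ∑ i, w i • x i with hc
  have key : ∀ t ∈ Ioo (0 : ℝ) 1, (1 - t) * ‖x j - c‖ ^ 2 ≤ A - ‖c‖ ^ 2 := by
    rintro t ⟨ht0, ht1⟩
    have hmem : (1 - t) • w + t • Pi.single j (1 : ℝ) ∈ stdSimplex ℝ ι :=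
      convex_stdSimplex ℝ ι hw (single_mem_stdSimplex ℝ j) (by linarith) ht0.le (by ring)
    have h := isMaxOn_iff.1 hmax _ hmem
    have e1 : ∑ i, ((1 - t) • w + t • Pi.single j (1 : ℝ) : ι → ℝ) i * ‖x i‖ ^ 2 =
        (1 - t) * A + t * ‖x j‖ ^ 2 := by
      simp [add_mul, Finset.sum_add_distrib, hA, Finset.mul_sum, mul_assoc, Pi.single_apply]
    have e2 : ∑ i, ((1 - t) • w + t • Pi.single j (1 : ℝ) : ι → ℝ) i • x i = (1 - t) • c + t • x j := by
      simp [add_smul, Finset.sum_add_distrib, hc, Finset.smul_sum, mul_smul, Pi.single_apply,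
        ite_smul]
    have e3 : ‖(1 - t) • c + t • x j‖ ^ 2 =
        (1 - t) ^ 2 * ‖c‖ ^ 2 + 2 * t * (1 - t) * inner ℝ c (x j) + t ^ 2 * ‖x j‖ ^ 2 := by
      rw [norm_add_sq_real, norm_smul, norm_smul, real_inner_smul_left, real_inner_smul_right,
        mul_pow, mul_pow, Real.norm_eq_abs, Real.norm_eq_abs, sq_abs, sq_abs]
      ring
    simp only [e1, e2, e3] at h
    have e4 : ‖x j - c‖ ^ 2 = ‖x j‖ ^ 2 - 2 * inner ℝ c (x j) + ‖c‖ ^ 2 := by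
      rw [norm_sub_sq_real, real_inner_comm]
    rw [e4]
    refine le_of_mul_le_mul_left ?_ ht0
    rw [← hA, ← hc] at h
    nlinarith
  have hlim : Filter.Tendsto (fun t : ℝ => (1 - t) * ‖x j - c‖ ^ 2) (nhdsWithin 0 (Ioi 0))
      (nhds ((1 - 0) * ‖x j - c‖ ^ 2)) :=
    (Continuous.tendsto (by fun_prop) 0).mono_left nhdsWithin_le_nhds
  have := le_of_tendsto hlim
    (Filter.mem_of_superset (Ioo_mem_nhdsGT (zero_lt_one (α := ℝ))) key)
  simpa using this

/-- **Jung's theorem** for finite families. -/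
lemma exists_norm_sub_le_of_fintype {ι : Type*} [Fintype ι] [Nonempty ι] (x : ι → E) {D r : ℝ}
    (hr : 0 ≤ r) (hD : ∀ i j, ‖x i - x j‖ ≤ D)
    (h : D ^ 2 * (Fintype.card ι - 1) ≤ 2 * Fintype.card ι * r ^ 2) :
    ∃ c, ∀ j, ‖x j - c‖ ≤ r := by
  classical
  obtain ⟨w, ⟨hw0, hw1⟩, hw⟩ := exists_weights_norm_sub_sq_le_variance x
  refine ⟨_, fun j => abs_le_of_sq_le_sq' ((hw j).trans ?_) hr |>.2⟩
  have hm : (0 : ℝ) < Fintype.card ι := by exact_mod_cast Fintype.card_pos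
  have hvar := sum_sum_mul_norm_sub_sq w x
  have hle : ∑ i, ∑ j, w i * w j * ‖x i - x j‖ ^ 2 ≤ D ^ 2 * (1 - ∑ i, w i ^ 2) := by
    have : D ^ 2 * (1 - ∑ i, w i ^ 2) =
        ∑ i, ∑ j, (w i * w j * D ^ 2 - if i = j then w i * w j * D ^ 2 else 0) := by
      simp only [Finset.sum_sub_distrib, Finset.sum_ite_eq, Finset.mem_univ, if_true,
        ← Finset.mul_sum, ← Finset.sum_mul, hw1, ← sq]
      ring
    rw [this]
    refine Finset.sum_le_sum fun i _ => Finset.sum_le_sum fun k _ => ?_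
    split_ifs with hik
    · simp [hik]
    · rw [sub_zero]
      exact mul_le_mul_of_nonneg_left (pow_le_pow_left₀ (norm_nonneg _) (hD i k) 2)
        (mul_nonneg (hw0 i) (hw0 k))
  have hcs : 1 ≤ Fintype.card ι * ∑ i, w i ^ 2 := by
    simpa [hw1] using sq_sum_le_card_mul_sum_sq (s := Finset.univ) (f := w)
  rw [hw1] at hvar
  refine le_of_mul_le_mul_left ?_ hm
  nlinarith [sq_nonneg D]

/-- **Jung's theorem**: a set of diameter at most `D` in a `d`-dimensional Euclidean space lies in
a ball of radius `D * √(d / (2 * (d + 1)))`. -/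
theorem exists_subset_closedBall_of_dist_le [FiniteDimensional ℝ E] {K : Set E} {D r : ℝ}
    (hr : 0 ≤ r) (hD : ∀ x ∈ K, ∀ y ∈ K, dist x y ≤ D)
    (h : D ^ 2 * finrank ℝ E ≤ 2 * (finrank ℝ E + 1) * r ^ 2) :
    ∃ c, K ⊆ Metric.closedBall c r := by
  obtain ⟨c, hc⟩ := Convex.helly_theorem_compact' (𝕜 := ℝ)
    (F := fun x : K => Metric.closedBall (x : E) r)
    (fun x => convex_closedBall _ _) (fun x => isCompact_closedBall _ _) (by
      intro I hI
      rcases I.eq_empty_or_nonempty with rfl | hne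
      · simp
      have : Nonempty I := hne.to_subtype
      have hm : (1 : ℝ) ≤ Fintype.card I := by exact_mod_cast Fintype.card_pos
      have hmd : (Fintype.card I : ℝ) ≤ finrank ℝ E + 1 := by
        rw [Fintype.card_coe]; exact_mod_cast hI
      obtain ⟨c, hc⟩ := exists_norm_sub_le_of_fintype (fun i : I => ((i : K) : E)) hr
        (fun i j => by rw [← dist_eq_norm]; exact hD _ i.1.2 _ j.1.2) (by
          have hd : (0 : ℝ) < finrank ℝ E + 1 := by positivity
          refine le_of_mul_le_mul_left ?_ hd
          have h1 := mul_le_mul_of_nonneg_left h (zero_le_one.trans hm)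
          nlinarith [mul_nonneg (sq_nonneg D) (sub_nonneg.2 hmd)])
      refine ⟨c, mem_iInter₂.2 fun i hi => ?_⟩
      rw [Metric.mem_closedBall, dist_comm, dist_eq_norm]
      exact hc ⟨i, hi⟩)
  refine ⟨c, fun x hx => ?_⟩
  rw [Metric.mem_closedBall, dist_comm]
  exact mem_iInter.1 hc ⟨x, hx⟩

end Jung

/-- The quadratic equation satisfied by the extremal asymmetry. -/
lemma asym_bound_quadratic (n : ℕ) :
    ((n : ℝ) + 2) * ((n + Real.sqrt (2 * n * (n + 1))) / (n + 2)) ^ 2 =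
      2 * n * ((n + Real.sqrt (2 * n * (n + 1))) / (n + 2)) + n := by
  have h : Real.sqrt (2 * n * (n + 1)) ^ 2 = 2 * n * ((n : ℝ) + 1) := Real.sq_sqrt (by positivity)
  set q := Real.sqrt (2 * n * (n + 1))
  field_simp
  linarith

/-- The bound on the reflected copy for sets whose circumscribed and inscribed balls are related as for bodies
of constant width `D`. -/
lemma exists_neg_subset_of_closedBall_subset {n : ℕ} {K : Set (V n)} {D s : ℝ} (hD : 0 < D)
    (hdist : ∀ x ∈ K, ∀ y ∈ K, dist x y ≤ D)
    (hball : ∀ c : V n, ∀ r < D, K ⊆ Metric.closedBall c r → Metric.closedBall c (D - r) ⊆ K)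
    (hs : 0 < s) (hq : ((n : ℝ) + 2) * s ^ 2 = 2 * n * s + n) :
    ∃ c : V n, -K ⊆ c +ᵥ s • K := by
  obtain ⟨c, hc⟩ := exists_subset_closedBall_of_dist_le (K := K) (D := D) (r := s * D / (1 + s))
    (by positivity) hdist (by
      rw [finrank_euclideanSpace_fin]
      have : 2 * ((n : ℝ) + 1) * s ^ 2 = n * (1 + s) ^ 2 := by linarith
      rw [div_pow, mul_pow, mul_div_assoc', le_div_iff₀ (by positivity)]
      nlinarith)
  have hr : D - s * D / (1 + s) = D / (1 + s) := by field_simp; ring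
  have hlt : s * D / (1 + s) < D := by
    have : 0 < D / (1 + s) := by positivity
    linarith
  have hin := hball c _ hlt hc
  rw [hr] at hin
  refine ⟨-c - s • c, fun x hx => ?_⟩
  have hx' := hc (mem_neg.1 hx)
  rw [Metric.mem_closedBall, dist_eq_norm] at hx'
  refine ⟨s • (c + s⁻¹ • (x + c)), smul_mem_smul_set (hin ?_), ?_⟩
  · rw [Metric.mem_closedBall, dist_eq_norm, add_sub_cancel_left, norm_smul, Real.norm_eq_abs,
      abs_of_pos (inv_pos.2 hs), inv_mul_le_iff₀ hs, ← norm_neg, neg_add', ← mul_div_assoc]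
    exact hx'
  · simp only [vadd_eq_add, smul_add, smul_inv_smul₀ hs.ne']
    abel

lemma asym_le {n : ℕ} {K : Set (V n)} {s : ℝ} (hs : 0 < s) (h : ∃ c : V n, -K ⊆ c +ᵥ s • K) :
    asym K ≤ s :=
  csInf_le ⟨0, fun _ hρ => hρ.1.le⟩ ⟨hs, h⟩

/-- A constant width body contained in a ball contains the concentric complementary ball. -/
lemma closedBall_subset_of_sub_eq_closedBall {n : ℕ} {K : Set (V n)} (hconv : Convex ℝ K)
    (hcl : IsClosed K) {w : ℝ} (hw : 0 < w) (hK : K - K = Metric.closedBall 0 w) (c : V n) (r : ℝ)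
    (hKr : K ⊆ Metric.closedBall c r) : Metric.closedBall c (w - r) ⊆ K := by
  intro p hp
  by_contra hpK
  obtain ⟨f, u, hfu, hup⟩ := geometric_hahn_banach_closed_point hconv hcl hpK
  set a := (InnerProductSpace.toDual ℝ (V n)).symm f with ha
  have hf : ∀ y, f y = inner ℝ a y := fun y => by
    rw [ha, InnerProductSpace.toDual_symm_apply]
  have h0 : (0 : V n) ∈ K - K := by rw [hK]; simp [hw.le]
  obtain ⟨z, hz, -⟩ := h0
  have ha0 : 0 < ‖a‖ := by
    refine norm_pos_iff.2 fun h => ?_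
    have h1 := (hfu z hz).trans hup
    simp [hf, h] at h1
  have hmem : (w / ‖a‖) • a ∈ K - K := by
    rw [hK, mem_closedBall_zero_iff, norm_smul, Real.norm_eq_abs, abs_of_pos (by positivity),
      div_mul_cancel₀ _ ha0.ne']
  obtain ⟨x, hx, y, hy, hxy⟩ := hmem
  have hxy' : inner ℝ a x - inner ℝ a y = w * ‖a‖ := by
    have : inner ℝ a (x - y) = w * ‖a‖ := by
      rw [show x - y = (w / ‖a‖) • a from hxy, real_inner_smul_right, real_inner_self_eq_norm_sq]
      field_simp
    rwa [inner_sub_right] at this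
  have hxp : inner ℝ a x < inner ℝ a p := by
    rw [← hf, ← hf]; exact (hfu x hx).trans hup
  have hp' : inner ℝ a p - inner ℝ a c ≤ ‖a‖ * (w - r) := by
    rw [← inner_sub_right]
    refine (real_inner_le_norm _ _).trans (mul_le_mul_of_nonneg_left ?_ ha0.le)
    rwa [Metric.mem_closedBall, dist_eq_norm] at hp
  have hy' : inner ℝ a c - inner ℝ a y ≤ ‖a‖ * r := by
    rw [← inner_sub_right]
    refine (real_inner_le_norm _ _).trans (mul_le_mul_of_nonneg_left ?_ ha0.le)
    have := hKr hy
    rwa [Metric.mem_closedBall, dist_comm, dist_eq_norm] at this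
  linarith

lemma gauge_euclBall {n : ℕ} (x : V n) : gauge (euclBall n) x = ‖x‖ := by
  rw [euclBall, gauge_closedBall zero_le_one, div_one]

lemma dist_le_mdiam {n : ℕ} {K : Set (V n)} (hK : Bornology.IsBounded K) {x y : V n} (hx : x ∈ K)
    (hy : y ∈ K) : dist x y ≤ mdiam (euclBall n) K := by
  refine le_csSup ⟨Metric.diam K, ?_⟩ ⟨x, hx, y, hy, by rw [gauge_euclBall, dist_eq_norm]⟩
  rintro _ ⟨a, ha, b, hb, rfl⟩
  rw [gauge_euclBall, ← dist_eq_norm]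
  exact Metric.dist_le_diam_of_mem hK ha hb

lemma mdiam_le_s12 {n : ℕ} {K : Set (V n)} {D : ℝ} (hD : 0 ≤ D)
    (h : ∀ x ∈ K, ∀ y ∈ K, dist x y ≤ D) : mdiam (euclBall n) K ≤ D := by
  refine Real.sSup_le ?_ hD
  rintro _ ⟨a, ha, b, hb, rfl⟩
  rw [gauge_euclBall, ← dist_eq_norm]
  exact h a ha b hb

/-- A complete body contains every point whose distance to the body's points is at most the
diameter. -/
lemma IsCompleteBody.mem_of_dist_le {n : ℕ} {K : Set (V n)} (hK : IsCompleteBody (euclBall n) K)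
    {p : V n} (hp : ∀ y ∈ K, dist p y ≤ mdiam (euclBall n) K) : p ∈ K := by
  by_contra hpK
  have hb := hK.1.2.1.isBounded
  obtain ⟨z, hz⟩ := hK.1.2.2.mono interior_subset
  have h0 : 0 ≤ mdiam (euclBall n) K := dist_nonneg.trans (hp z hz)
  refine (hK.2 p hpK).not_ge (mdiam_le_s12 h0 ?_)
  rintro x (hx | rfl) y (hy | rfl)
  · exact dist_le_mdiam hb hx hy
  · rw [dist_comm]; exact hp x hx
  · exact hp y hy
  · rwa [dist_self]

/-- A set of diameter at most `D` containing the vertices of a regular `n`-simplex with edge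
length `D` has asymmetry at least the extremal value. -/
lemma le_of_neg_subset_of_regular_simplex {n : ℕ} {K : Set (V n)} {D s ρ : ℝ} (hD : 0 < D)
    (hdist : ∀ x ∈ K, ∀ y ∈ K, dist x y ≤ D) {v : Fin (n + 1) → V n} (hv : ∀ i, v i ∈ K)
    (hvD : ∀ i j, i ≠ j → dist (v i) (v j) = D) (hρ : 0 < ρ) {c : V n}
    (hc : -K ⊆ c +ᵥ ρ • K) (hn : 1 ≤ n) (hs : 0 < s)
    (hq : ((n : ℝ) + 2) * s ^ 2 = 2 * n * s + n) : s ≤ ρ := by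
  have hx : ∀ i, ‖(ρ + 1) • v i + c‖ ≤ ρ * D := by
    intro i
    obtain ⟨_, ⟨k, hk, rfl⟩, hki⟩ := hc (neg_mem_neg.2 (hv i))
    have hki' : c + ρ • k = -v i := hki
    have : (ρ + 1) • v i + c = ρ • (v i - k) := by
      rw [eq_sub_of_add_eq hki', add_smul, one_smul, smul_sub]; abel
    rw [this, norm_smul, Real.norm_eq_abs, abs_of_pos hρ, ← dist_eq_norm]
    exact mul_le_mul_of_nonneg_left (hdist _ (hv i) _ hk) hρ.le
  have hsum := sum_sum_mul_norm_sub_sq (fun _ => (1 : ℝ)) fun i => (ρ + 1) • v i + c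
  have hL : ∑ i : Fin (n + 1), ∑ j : Fin (n + 1),
      (1 : ℝ) * 1 * ‖((ρ + 1) • v i + c) - ((ρ + 1) • v j + c)‖ ^ 2 =
      (n + 1) * n * ((ρ + 1) * D) ^ 2 := by
    have : ∀ i j : Fin (n + 1), (1 : ℝ) * 1 * ‖((ρ + 1) • v i + c) - ((ρ + 1) • v j + c)‖ ^ 2 =
        ((ρ + 1) * D) ^ 2 - if i = j then ((ρ + 1) * D) ^ 2 else 0 := by
      intro i j
      rw [add_sub_add_right_eq_sub, ← smul_sub, norm_smul, ← dist_eq_norm, Real.norm_eq_abs,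
        abs_of_pos (by positivity)]
      split_ifs with h
      · simp [h]
      · rw [hvD i j h]; ring
    simp only [this, Finset.sum_sub_distrib, Finset.sum_ite_eq, Finset.mem_univ, if_true]
    simp
    ring
  have hR : ∑ i : Fin (n + 1), (1 : ℝ) * ‖(ρ + 1) • v i + c‖ ^ 2 ≤ (n + 1) * (ρ * D) ^ 2 := by
    calc _ ≤ ∑ i : Fin (n + 1), (ρ * D) ^ 2 := Finset.sum_le_sum fun i _ => by
          rw [one_mul]; exact pow_le_pow_left₀ (norm_nonneg _) (hx i) 2
      _ = _ := by simp
  have hone : ∑ i : Fin (n + 1), (1 : ℝ) = n + 1 := by simp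
  rw [hL, hone] at hsum
  have hn1 : (1 : ℝ) ≤ n := by exact_mod_cast hn
  have hmain : (n : ℝ) * (ρ + 1) ^ 2 ≤ 2 * (n + 1) * ρ ^ 2 := by
    refine le_of_mul_le_mul_left ?_ (show 0 < ((n : ℝ) + 1) * D ^ 2 by positivity)
    have := mul_le_mul_of_nonneg_left hR (show (0 : ℝ) ≤ 2 * (n + 1) by positivity)
    nlinarith [sq_nonneg ‖∑ i, (1 : ℝ) • ((ρ + 1) • v i + c)‖]
  by_contra hlt
  push Not at hlt
  have hfac : 0 < s * ((n + 2) * (ρ + s) - 2 * n) := by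
    have : s * ((n + 2) * (ρ + s) - 2 * n) = (n + 2) * s * ρ + n := by linarith
    rw [this]; positivity
  have hfac' := pos_of_mul_pos_right hfac hs.le
  nlinarith [mul_pos (sub_pos.2 hlt) hfac']

/-- Every Euclidean constant width body `K` satisfies
`s(K) ≤ (n + √(2n(n+1)))/(n+2)`, with equality for completions of regular
simplices. -/
theorem stmt12 {n : ℕ} (hn : 1 ≤ n) :
    (∀ K : Set (V n), IsConvexBody K → IsConstWidth (euclBall n) K →
      asym K ≤ (n + Real.sqrt (2 * n * (n + 1))) / (n + 2)) ∧
    (∀ K T : Set (V n), IsRegularSimplex T → IsCompletionOf (euclBall n) K T →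
      asym K = (n + Real.sqrt (2 * n * (n + 1))) / (n + 2)) := by
  have hn0 : (0 : ℝ) < n := by exact_mod_cast hn
  have hq := asym_bound_quadratic n
  have hs : 0 < ((n : ℝ) + Real.sqrt (2 * n * (n + 1))) / (n + 2) := by positivity
  set s := ((n : ℝ) + Real.sqrt (2 * n * (n + 1))) / (n + 2)
  constructor
  · rintro K ⟨hconv, hcomp, -⟩ ⟨w, hw, hK⟩
    have hK' : K - K = Metric.closedBall 0 w := by
      rw [hK, euclBall, smul_closedBall _ _ zero_le_one, smul_zero, Real.norm_eq_abs,
        abs_of_pos hw, mul_one]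
    refine asym_le hs (exists_neg_subset_of_closedBall_subset hw (fun x hx y hy => ?_)
      (fun c r _ => closedBall_subset_of_sub_eq_closedBall hconv hcomp.isClosed hw hK' c r) hs hq)
    have : x - y ∈ K - K := sub_mem_sub hx hy
    rwa [hK', mem_closedBall_zero_iff, ← dist_eq_norm] at this
  · rintro K T ⟨v, hv, hreg, rfl⟩ ⟨hK, hTK, hdiam⟩
    have h01 : (0 : Fin (n + 1)) ≠ Fin.last n := by
      rw [Ne, Fin.ext_iff]; simp; omega
    have hvD : ∀ i j, i ≠ j → dist (v i) (v j) = dist (v 0) (v (Fin.last n)) :=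
      fun i j hij => hreg i j _ _ hij h01
    have hD : 0 < dist (v 0) (v (Fin.last n)) := dist_pos.2 (hv.injective.ne h01)
    have hvK : ∀ i, v i ∈ K := fun i => hTK (subset_convexHull ℝ _ (mem_range_self i))
    have hb := hK.1.2.1.isBounded
    have hmd : mdiam (euclBall n) K = dist (v 0) (v (Fin.last n)) := by
      refine le_antisymm ?_ (dist_le_mdiam hb (hvK _) (hvK _))
      rw [hdiam]
      refine mdiam_le_s12 hD.le fun x hx y hy => ?_
      obtain ⟨_, ⟨i, rfl⟩, _, ⟨j, rfl⟩, hij⟩ := convexHull_exists_dist_ge2 hx hy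
      refine hij.trans ?_
      rcases eq_or_ne i j with rfl | h
      · rw [dist_self]; exact hD.le
      · exact (hvD i j h).le
    have hdist : ∀ x ∈ K, ∀ y ∈ K, dist x y ≤ dist (v 0) (v (Fin.last n)) :=
      fun x hx y hy => hmd ▸ dist_le_mdiam hb hx hy
    have hball : ∀ c : V n, ∀ r < dist (v 0) (v (Fin.last n)), K ⊆ Metric.closedBall c r →
        Metric.closedBall c (dist (v 0) (v (Fin.last n)) - r) ⊆ K := by
      refine fun c r _ hKr p hp => hK.mem_of_dist_le fun y hy => ?_
      have h1 := Metric.mem_closedBall.1 hp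
      have h2 := Metric.mem_closedBall'.1 (hKr hy)
      rw [hmd]
      linarith [dist_triangle p c y]
    have hsK := exists_neg_subset_of_closedBall_subset hD hdist hball hs hq
    exact le_antisymm (asym_le hs hsK) (le_csInf ⟨s, hs, hsK⟩ fun ρ ⟨hρ, c, hc⟩ =>
      le_of_neg_subset_of_regular_simplex hD hdist hvK hvD hρ hc hn hs hq)
end
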